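/- There exists a universal constant C > 0 with the following property. Let 𝒴 be a finite label set, π : 𝒴 → (0, 1] a probability vector, and for each y' ∈ 𝒴 let μ_{y'} be a probability measure on ℝ^d; set μ = Σ_{y'∈𝒴} π(y') μ_{y'}. Let λ ∈ (0, 1], σ > 0, and let f and f_y denote the Gaussian-smoothed densities of μ and of μ_y for a fixed label y with π(y) > 0. Then for every ε ∈ (0, 1): (a) the probability measure with density f_y assigns mass at most ε/π(y) to { x : ‖∇ log f_y(x) − ∇ log f(x)‖₂ > C √(d + log(1/ε)) / σ }; and (b) it assigns mass at most ε/π(y) to { x : |Tr( ∇² log f_y(x) − ∇² log f(x) )| > C (d + log(1/ε)) / σ² }. -/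

import Mathlib

open MeasureTheory Real

/-- The Gaussian kernel `(2πσ²)^{-d/2} exp(-‖x - λz‖²/(2σ²))`. -/
noncomputable def gaussKernel (d : ℕ) (lam sig : ℝ)
    (x z : EuclideanSpace ℝ (Fin d)) : ℝ :=
  (2 * π * sig ^ 2) ^ (-(d : ℝ) / 2) * Real.exp (-‖x - lam • z‖ ^ 2 / (2 * sig ^ 2))

/-- The Gaussian-smoothed density of a measure `μ`. -/
noncomputable def smoothedDensity (d : ℕ) (lam sig : ℝ)
    (μ : Measure (EuclideanSpace ℝ (Fin d))) (x : EuclideanSpace ℝ (Fin d)) : ℝ :=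
  ∫ z, gaussKernel d lam sig x z ∂μ

/-- The trace of the Hessian of `f : ℝ^d → ℝ` at `x`. -/
noncomputable def hessTrace {d : ℕ} (f : EuclideanSpace ℝ (Fin d) → ℝ)
    (x : EuclideanSpace ℝ (Fin d)) : ℝ :=
  ∑ i, iteratedFDeriv ℝ 2 f x ![EuclideanSpace.single i 1, EuclideanSpace.single i 1]

/-- The mixture measure `μ = Σ_{y'} π(y') μ_{y'}`. -/
noncomputable def mixture {d : ℕ} {𝒴 : Type*} [Fintype 𝒴] (prior : 𝒴 → ℝ)
    (μs : 𝒴 → Measure (EuclideanSpace ℝ (Fin d))) :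
    Measure (EuclideanSpace ℝ (Fin d)) :=
  ∑ y', ENNReal.ofReal (prior y') • μs y'


section key
set_option maxSynthPendingDepth 3
set_option linter.unusedSectionVars false
variable {E : Type*} [NormedAddCommGroup E] [InnerProductSpace ℝ E]

noncomputable def iL (E : Type*) [NormedAddCommGroup E] [InnerProductSpace ℝ E] : E →L[ℝ] E →L[ℝ] ℝ := innerSL ℝ

@[simp] lemma iL_apply (v w : E) : iL E v w = inner ℝ v w := rfl

lemma iL_norm (v : E) : ‖iL E v‖ = ‖v‖ := innerSL_apply_norm ℝ v

noncomputable def phi (c s : ℝ) (w : E) : ℝ := c * Real.exp (-(s / 2 * ‖w‖ ^ 2))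

noncomputable def phi1 (c s : ℝ) (w : E) : E →L[ℝ] ℝ :=
  (-(s * phi c s w)) • iL E w

noncomputable def phi2 (c s : ℝ) (w : E) : E →L[ℝ] E →L[ℝ] ℝ :=
  (-(s * phi c s w)) • (iL E) + (s ^ 2 * phi c s w) • (iL E w).smulRight (iL E w)

lemma phi_hasFDerivAt (c s : ℝ) (w : E) : HasFDerivAt (phi c s) (phi1 c s w) w := by
  have h1 : HasFDerivAt (fun w : E => ‖w‖ ^ 2) (2 • innerSL ℝ w) w :=
    (hasStrictFDerivAt_norm_sq w).hasFDerivAt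
  have h2 := (((h1.const_mul (s / 2)).neg).exp).const_mul c
  refine h2.congr_fderiv ?_
  ext v
  simp [phi1, phi]
  ring

lemma phi1_hasFDerivAt (c s : ℝ) (w : E) :
    HasFDerivAt (phi1 c s) (phi2 c s w) w := by
  have h1 := ((phi_hasFDerivAt c s w).const_mul s).neg
  have h2 : HasFDerivAt (fun w : E => iL E w) (iL E) w :=
    (iL E).hasFDerivAt
  refine (h1.smul h2).congr_fderiv ?_
  ext v u
  simp [phi1, phi2]
  ring

lemma phi_continuous (c s : ℝ) : Continuous (phi (E := E) c s) := by
  unfold phi; fun_prop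

lemma phi1_continuous (c s : ℝ) : Continuous (phi1 (E := E) c s) :=
  continuous_iff_continuousAt.2 fun w => (phi1_hasFDerivAt c s w).continuousAt

lemma phi2_continuous (c s : ℝ) : Continuous (phi2 (E := E) c s) := by
  have := phi_continuous (E := E) c s
  have h : Continuous fun w : E => (iL E w).smulRight (iL E w) := by
    have : (fun w : E => (iL E w).smulRight (iL E w)) =
      fun w => ContinuousLinearMap.smulRightL ℝ (E) (E →L[ℝ] ℝ) (iL E w) (iL E w) := by
      ext; simp
    rw [this]; fun_prop
  have h1 : Continuous fun w : E => -(s * phi c s w) := by fun_prop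
  have h2 : Continuous fun w : E => s ^ 2 * phi c s w := by fun_prop
  exact (h1.smul continuous_const).add (h2.smul h)

lemma phi_nonneg {c s : ℝ} (hc : 0 < c) (w : E) : 0 < phi c s w := by
  unfold phi; positivity

lemma phi_le {c s : ℝ} (hc : 0 < c) (hs : 0 < s) (w : E) : phi c s w ≤ c := by
  unfold phi
  have h : 0 ≤ s / 2 * ‖w‖ ^ 2 := by positivity
  have : Real.exp (-(s / 2 * ‖w‖ ^ 2)) ≤ 1 := Real.exp_le_one_iff.2 (by linarith)
  nlinarith

lemma phi_sq_le {c s : ℝ} (hc : 0 < c) (hs : 0 < s) (w : E) :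
    phi c s w * ‖w‖ ^ 2 ≤ 2 * c / s := by
  unfold phi
  rw [Real.exp_neg, le_div_iff₀ hs]
  have h := Real.add_one_le_exp (s / 2 * ‖w‖ ^ 2)
  have h0 := Real.exp_pos (s / 2 * ‖w‖ ^ 2)
  have : s / 2 * ‖w‖ ^ 2 * (Real.exp (s / 2 * ‖w‖ ^ 2))⁻¹ ≤ 1 := by
    rw [← div_eq_mul_inv, div_le_one h0]; linarith
  nlinarith

lemma phi_norm_le {c s : ℝ} (hc : 0 < c) (hs : 0 < s) (w : E) :
    phi c s w * ‖w‖ ≤ c + 2 * c / s := by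
  have h1 := phi_sq_le hc hs w
  have h2 := phi_le hc hs w
  have h3 := phi_nonneg (s := s) hc w
  have : ‖w‖ ≤ 1 + ‖w‖ ^ 2 := by nlinarith [sq_nonneg (‖w‖ - 1), norm_nonneg w]
  nlinarith

lemma phi1_norm {c s : ℝ} (hc : 0 < c) (hs : 0 < s) (w : E) :
    ‖phi1 c s w‖ ≤ s * (phi c s w * ‖w‖) := by
  have h3 := phi_nonneg (s := s) hc w
  unfold phi1
  rw [norm_smul, iL_norm, norm_neg, Real.norm_of_nonneg (by positivity)]
  linarith

lemma phi2_norm {c s : ℝ} (hc : 0 < c) (hs : 0 < s) (w : E) :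
    ‖phi2 c s w‖ ≤ s * c * ‖(iL E)‖ + s ^ 2 * (2 * c / s) := by
  have h3 := phi_nonneg (s := s) hc w
  unfold phi2
  refine le_trans (norm_add_le ((-(s * phi c s w)) • iL E) ((s ^ 2 * phi c s w) • (iL E w).smulRight (iL E w)))
    (add_le_add ?_ ?_)
  · rw [norm_smul, norm_neg, Real.norm_of_nonneg (by positivity)]
    gcongr
    exact phi_le hc hs w
  · rw [norm_smul, ContinuousLinearMap.norm_smulRight_apply, iL_norm,
      Real.norm_of_nonneg (by positivity), mul_assoc]
    gcongr
    have := phi_sq_le hc hs w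
    nlinarith

variable [FiniteDimensional ℝ E] [MeasurableSpace E] [BorelSpace E]

lemma bdd_int {G : Type*} [NormedAddCommGroup G] [NormedSpace ℝ G]
    (μ : Measure (E)) [IsProbabilityMeasure μ] (lam : ℝ) (x : E) {F : E → G}
    (hF : Continuous F) {A : ℝ} (hA : ∀ w, ‖F w‖ ≤ A) : Integrable (fun z => F (x - lam • z)) μ :=
  Integrable.of_bound (C := A) (Continuous.aestronglyMeasurable (by fun_prop))
    (Filter.Eventually.of_forall fun z => hA _)

lemma diff_int {G : Type*} [NormedAddCommGroup G] [NormedSpace ℝ G]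
    (μ : Measure (E)) [IsProbabilityMeasure μ] (lam : ℝ) (x : E) {F : E → G}
    {F' : E → E →L[ℝ] G} (hF : Continuous F) (hF' : Continuous F') {A B : ℝ}
    (hA : ∀ w, ‖F w‖ ≤ A) (hB : ∀ w, ‖F' w‖ ≤ B) (hd : ∀ w, HasFDerivAt F (F' w) w) :
    HasFDerivAt (fun x => ∫ z, F (x - lam • z) ∂μ) (∫ z, F' (x - lam • z) ∂μ) x := by
  refine hasFDerivAt_integral_of_dominated_of_fderiv_le (F := fun x z => F (x - lam • z))
    (F' := fun x z => F' (x - lam • z)) (bound := fun _ => B) Filter.univ_mem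
    (Filter.Eventually.of_forall fun x => (bdd_int μ lam x hF hA).1) (bdd_int μ lam x hF hA)
    (bdd_int μ lam x hF' hB).1 (Filter.Eventually.of_forall fun z x _ => hB _)
    (integrable_const _) (Filter.Eventually.of_forall fun z x _ => ?_)
  have := (hd (x - lam • z)).comp x ((hasFDerivAt_id x).sub_const (lam • z))
  simpa [Function.comp_def] using this

variable (μ : Measure (E)) [IsProbabilityMeasure μ] (lam : ℝ) {c s : ℝ}

lemma f_hasFDerivAt (hc : 0 < c) (hs : 0 < s) (x : E) :
    HasFDerivAt (fun x => ∫ z, phi c s (x - lam • z) ∂μ) (∫ z, phi1 c s (x - lam • z) ∂μ) x := by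
  refine diff_int μ lam x (A := c) (B := s * (c + 2 * c / s)) (phi_continuous c s)
    (phi1_continuous c s) (fun w => ?_) (fun w => ?_) (phi_hasFDerivAt c s)
  · rw [Real.norm_of_nonneg (phi_nonneg hc w).le]; exact phi_le hc hs w
  · exact (phi1_norm hc hs w).trans (by gcongr; exact phi_norm_le hc hs w)

lemma f1_hasFDerivAt (hc : 0 < c) (hs : 0 < s) (x : E) :
    HasFDerivAt (fun x => ∫ z, phi1 c s (x - lam • z) ∂μ) (∫ z, phi2 c s (x - lam • z) ∂μ) x := by
  refine diff_int μ lam x (A := s * (c + 2 * c / s)) (phi1_continuous c s)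
    (phi2_continuous c s) (fun w => ?_) (phi2_norm hc hs) (phi1_hasFDerivAt c s)
  exact (phi1_norm hc hs w).trans (by gcongr; exact phi_norm_le hc hs w)

lemma int_phi (hc : 0 < c) (hs : 0 < s) (x : E) :
    Integrable (fun z => phi c s (x - lam • z)) μ := by
  refine bdd_int μ lam x (A := c) (phi_continuous c s) (fun w => ?_)
  rw [Real.norm_of_nonneg (phi_nonneg hc w).le]; exact phi_le hc hs w

lemma int_phi_n (hc : 0 < c) (hs : 0 < s) (x : E) :
    Integrable (fun z => phi c s (x - lam • z) * ‖x - lam • z‖) μ := by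
  have := phi_continuous (E := E) c s
  refine bdd_int μ lam x (F := fun w => phi c s w * ‖w‖) (A := c + 2 * c / s) (by fun_prop) (fun w => ?_)
  have := (phi_nonneg (s := s) hc w).le
  rw [Real.norm_of_nonneg (by positivity)]; exact phi_norm_le hc hs w

lemma int_phi_sq (hc : 0 < c) (hs : 0 < s) (x : E) :
    Integrable (fun z => phi c s (x - lam • z) * ‖x - lam • z‖ ^ 2) μ := by
  have := phi_continuous (E := E) c s
  refine bdd_int μ lam x (F := fun w => phi c s w * ‖w‖ ^ 2) (A := 2 * c / s) (by fun_prop) (fun w => ?_)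
  have := (phi_nonneg (s := s) hc w).le
  rw [Real.norm_of_nonneg (by positivity)]; exact phi_sq_le hc hs w

lemma int_phi2 (hc : 0 < c) (hs : 0 < s) (x : E) :
    Integrable (fun z => phi2 c s (x - lam • z)) μ :=
  bdd_int μ lam x (phi2_continuous c s) (phi2_norm hc hs)

lemma f_pos (hc : 0 < c) (hs : 0 < s) (x : E) : 0 < ∫ z, phi c s (x - lam • z) ∂μ := by
  rw [integral_pos_iff_support_of_nonneg (fun z => (phi_nonneg hc _).le) (int_phi μ lam hc hs x)]
  have : (Function.support fun z => phi c s (x - lam • z)) = Set.univ := by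
    ext z; simp [(phi_nonneg (s := s) hc (x - lam • z)).ne']
  rw [this]; simp

lemma cs (hc : 0 < c) (hs : 0 < s) (x : E) :
    (∫ z, phi c s (x - lam • z) * ‖x - lam • z‖ ∂μ) ^ 2 ≤
      (∫ z, phi c s (x - lam • z) ∂μ) * ∫ z, phi c s (x - lam • z) * ‖x - lam • z‖ ^ 2 ∂μ := by
  have hf := f_pos μ lam hc hs x
  have i0 := int_phi μ lam hc hs x
  have i1 := int_phi_n μ lam hc hs x
  have i2 := int_phi_sq μ lam hc hs x
  have e : ∀ a b : ℝ, ∫ z, phi c s (x - lam • z) * (a * ‖x - lam • z‖ - b) ^ 2 ∂μ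
      = a ^ 2 * (∫ z, phi c s (x - lam • z) * ‖x - lam • z‖ ^ 2 ∂μ)
        - 2 * a * b * (∫ z, phi c s (x - lam • z) * ‖x - lam • z‖ ∂μ)
        + b ^ 2 * ∫ z, phi c s (x - lam • z) ∂μ := by
    intro a b
    rw [← integral_const_mul, ← integral_const_mul, ← integral_const_mul, ← integral_sub, ← integral_add]
    · congr 1; ext z; ring
    · exact (i2.const_mul _).sub (i1.const_mul _)
    · exact i0.const_mul _
    · exact i2.const_mul _
    · exact i1.const_mul _
  have h : ∀ a b : ℝ, 0 ≤ ∫ z, phi c s (x - lam • z) * (a * ‖x - lam • z‖ - b) ^ 2 ∂μ :=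
    fun a b => integral_nonneg fun z => mul_nonneg (phi_nonneg hc _).le (sq_nonneg _)
  replace h := h (∫ z, phi c s (x - lam • z) ∂μ) (∫ z, phi c s (x - lam • z) * ‖x - lam • z‖ ∂μ)
  rw [e] at h
  clear e i0 i1 i2
  generalize ∫ z, phi c s (x - lam • z) ∂μ = f at *
  generalize ∫ z, phi c s (x - lam • z) * ‖x - lam • z‖ ^ 2 ∂μ = Q at *
  generalize ∫ z, phi c s (x - lam • z) * ‖x - lam • z‖ ∂μ = P at *
  have : 0 ≤ f * (f * Q - P ^ 2) := by nlinarith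
  have := nonneg_of_mul_nonneg_right this hf
  linarith

lemma f1_norm (hc : 0 < c) (hs : 0 < s) (x : E) :
    ‖∫ z, phi1 c s (x - lam • z) ∂μ‖ ≤ s * ∫ z, phi c s (x - lam • z) * ‖x - lam • z‖ ∂μ := by
  rw [← integral_const_mul]
  refine norm_integral_le_of_norm_le ((int_phi_n μ lam hc hs x).const_mul s) ?_
  exact Filter.Eventually.of_forall fun z => phi1_norm hc hs _

lemma sum_sq_le {ι : Type*} [Fintype ι] (b : OrthonormalBasis ι ℝ E) (ℓ : E →L[ℝ] ℝ) : ∑ i, (ℓ (b i)) ^ 2 ≤ ‖ℓ‖ ^ 2 := by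
  obtain ⟨g, rfl⟩ := (InnerProductSpace.toDual ℝ (E)).surjective ℓ
  rw [LinearIsometryEquiv.norm_map, ← b.sum_sq_inner_left]
  simp

lemma trace_f2 {ι : Type*} [Fintype ι] (b : OrthonormalBasis ι ℝ E) (hc : 0 < c) (hs : 0 < s) (x : E) :
    ∑ i, (∫ z, phi2 c s (x - lam • z) ∂μ) (b i) (b i)
    = -(Fintype.card ι * s) * ∫ z, phi c s (x - lam • z) ∂μ +
      s ^ 2 * ∫ z, phi c s (x - lam • z) * ‖x - lam • z‖ ^ 2 ∂μ := by
  have i2 := int_phi2 μ lam hc hs x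
  have h : ∀ i, (∫ z, phi2 c s (x - lam • z) ∂μ) (b i) (b i)
     = ∫ z, phi2 c s (x - lam • z) (b i) (b i) ∂μ := by
    intro i
    rw [ContinuousLinearMap.integral_apply i2, ContinuousLinearMap.integral_apply]
    exact i2.apply_continuousLinearMap _
  simp_rw [h]
  rw [← integral_finsetSum, ← integral_const_mul, ← integral_const_mul, ← integral_add]
  · congr 1; ext z
    have : ∀ i, phi2 c s (x - lam • z) (b i) (b i)
      = -(s * phi c s (x - lam • z)) + s ^ 2 * phi c s (x - lam • z) * (inner ℝ (x - lam • z) (b i)) ^ 2 := by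
      intro i
      generalize x - lam • z = w
      simp only [phi2, iL_apply, add_apply, smul_apply,
        ContinuousLinearMap.smulRight_apply, smul_eq_mul, real_inner_self_eq_norm_sq, b.norm_eq_one]
      ring
    simp_rw [this]
    rw [Finset.sum_add_distrib, ← Finset.mul_sum, b.sum_sq_inner_left]
    simp
    ring
  · exact (int_phi μ lam hc hs x).const_mul _
  · exact (int_phi_sq μ lam hc hs x).const_mul _
  · intro i _
    exact (i2.apply_continuousLinearMap _).apply_continuousLinearMap _

lemma key {ι : Type*} [Fintype ι] (b : OrthonormalBasis ι ℝ E) (hc : 0 < c) (hs : 0 < s) (x : E) {T : ℝ}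
    (hQ : s * ∫ z, phi c s (x - lam • z) * ‖x - lam • z‖ ^ 2 ∂μ ≤ T * ∫ z, phi c s (x - lam • z) ∂μ) :
    ‖gradient (fun x => Real.log (∫ z, phi c s (x - lam • z) ∂μ)) x‖ ^ 2 ≤ T * s ∧
    -(Fintype.card ι * s) ≤ ∑ i, fderiv ℝ (fderiv ℝ (fun x => Real.log (∫ z, phi c s (x - lam • z) ∂μ))) x (b i) (b i) ∧
    (∑ i, fderiv ℝ (fderiv ℝ (fun x => Real.log (∫ z, phi c s (x - lam • z) ∂μ))) x (b i) (b i)) ≤ -(Fintype.card ι * s) + T * s := by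
  have hcs := cs μ lam hc hs x
  have hn := f1_norm μ lam hc hs x
  have htr := trace_f2 μ lam b hc hs x
  have hpos := f_pos μ lam hc hs
  have d1 := f_hasFDerivAt μ lam hc hs
  have d2 := f1_hasFDerivAt μ lam hc hs x
  have dlog : ∀ x, HasFDerivAt (fun x => Real.log (∫ z, phi c s (x - lam • z) ∂μ))
    ((∫ z, phi c s (x - lam • z) ∂μ)⁻¹ • (∫ z, phi1 c s (x - lam • z) ∂μ)) x := fun x =>
      (d1 x).log (hpos x).ne'
  have dlog2 := ((hasDerivAt_inv (hpos x).ne').comp_hasFDerivAt x (d1 x)).smul d2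
  have e1 : fderiv ℝ (fun x => Real.log (∫ z, phi c s (x - lam • z) ∂μ)) = fun x =>
    ((∫ z, phi c s (x - lam • z) ∂μ)⁻¹ • (∫ z, phi1 c s (x - lam • z) ∂μ)) :=
    funext fun x => (dlog x).fderiv
  have e2 := dlog2.fderiv
  have hsum := sum_sq_le b (∫ z, phi1 c s (x - lam • z) ∂μ)
  have hsum0 : 0 ≤ ∑ i, ((∫ z, phi1 c s (x - lam • z) ∂μ) (b i)) ^ 2 := by positivity
  have hH : (∑ i, fderiv ℝ (fderiv ℝ (fun x => Real.log (∫ z, phi c s (x - lam • z) ∂μ))) x (b i) (b i)) =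
    (∫ z, phi c s (x - lam • z) ∂μ)⁻¹ * (∑ i, (∫ z, phi2 c s (x - lam • z) ∂μ) (b i) (b i))
     - ((∫ z, phi c s (x - lam • z) ∂μ) ^ 2)⁻¹ * ∑ i, ((∫ z, phi1 c s (x - lam • z) ∂μ) (b i)) ^ 2 := by
    rw [e1]
    rw [Finset.mul_sum, Finset.mul_sum, ← Finset.sum_sub_distrib]
    refine Finset.sum_congr rfl fun i _ => ?_
    refine (congrArg (fun A : E →L[ℝ] E →L[ℝ] ℝ => A (b i) (b i)) e2).trans ?_
    simp
    ring
  have hG : ‖gradient (fun x => Real.log (∫ z, phi c s (x - lam • z) ∂μ)) x‖ =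
    (∫ z, phi c s (x - lam • z) ∂μ)⁻¹ * ‖∫ z, phi1 c s (x - lam • z) ∂μ‖ := by
    rw [gradient, LinearIsometryEquiv.norm_map, e1]
    simp only
    rw [norm_smul, Real.norm_of_nonneg (inv_nonneg.2 (hpos x).le)]
  rw [hG, hH, htr]
  have hf := hpos x
  clear d1 d2 dlog dlog2 e1 e2 hH hG htr hpos
  have hN0 := norm_nonneg (∫ z, phi1 c s (x - lam • z) ∂μ)
  generalize ‖∫ z, phi1 c s (x - lam • z) ∂μ‖ = N at *
  generalize ∑ i, ((∫ z, phi1 c s (x - lam • z) ∂μ) (b i)) ^ 2 = S at *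
  generalize ∫ z, phi c s (x - lam • z) ∂μ = f at *
  generalize ∫ z, phi c s (x - lam • z) * ‖x - lam • z‖ ^ 2 ∂μ = Q at *
  generalize ∫ z, phi c s (x - lam • z) * ‖x - lam • z‖ ∂μ = P at *
  have hN : N ^ 2 ≤ s ^ 2 * (f * Q) := by
    calc N ^ 2 ≤ (s * P) ^ 2 := by gcongr
      _ = s ^ 2 * P ^ 2 := by ring
      _ ≤ _ := by gcongr
  have hN2 : s ^ 2 * (f * Q) ≤ T * s * f ^ 2 := by
    have := mul_le_mul_of_nonneg_left hQ (mul_pos hs hf).le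
    nlinarith
  have e : f⁻¹ * (-(Fintype.card ι * s) * f + s ^ 2 * Q) - (f ^ 2)⁻¹ * S = -(Fintype.card ι * s) + (s ^ 2 * (f * Q) - S) / f ^ 2 := by
    field_simp
    ring
  refine ⟨?_, ?_, ?_⟩
  · rw [mul_pow, inv_pow, inv_mul_le_iff₀ (by positivity)]
    linarith
  · rw [e]
    have : 0 ≤ (s ^ 2 * (f * Q) - S) / f ^ 2 := div_nonneg (by linarith) (by positivity)
    linarith
  · rw [e]
    have : (s ^ 2 * (f * Q) - S) / f ^ 2 ≤ T * s := by
      rw [div_le_iff₀ (by positivity)]; linarith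
    linarith

end key

abbrev VV (d : ℕ) := EuclideanSpace ℝ (Fin d)

lemma kernel_eq (d : ℕ) (lam : ℝ) {sig : ℝ} (x z : VV d) :
    gaussKernel d lam sig x z = phi ((2 * π * sig ^ 2) ^ (-(d : ℝ) / 2)) (1 / sig ^ 2) (x - lam • z) := by
  unfold gaussKernel phi
  congr 2
  by_cases h : sig = 0
  · simp [h]
  · field_simp

/-- The set where the posterior second moment is large. -/
def bad {d : ℕ} (c s lam : ℝ) (μ : Measure (VV d)) (T : ℝ) : Set (VV d) :=
  {x | T * ∫ z, phi c s (x - lam • z) ∂μ < s * ∫ z, phi c s (x - lam • z) * ‖x - lam • z‖ ^ 2 ∂μ}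

lemma bad_le {d : ℕ} (μ : Measure (VV d)) [IsProbabilityMeasure μ] (lam : ℝ) {c s : ℝ}
    (hc : 0 < c) (hs : 0 < s) {T : ℝ} {x : VV d} (hx : x ∈ bad c s lam μ T) :
    ∫ z, phi c s (x - lam • z) ∂μ ≤ Real.exp (-(T / 4)) * ∫ z, phi c (s / 2) (x - lam • z) ∂μ := by
  have i0 := int_phi μ lam hc hs x
  have i2 := int_phi_sq μ lam hc hs x
  have ig := int_phi μ lam hc (half_pos hs) x
  have h : Real.exp (T / 4) * ((1 - T / 4) * (∫ z, phi c s (x - lam • z) ∂μ) +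
      s / 4 * ∫ z, phi c s (x - lam • z) * ‖x - lam • z‖ ^ 2 ∂μ) ≤ ∫ z, phi c (s / 2) (x - lam • z) ∂μ := by
    rw [← integral_const_mul, ← integral_const_mul, ← integral_add (i0.const_mul _) (i2.const_mul _),
      ← integral_const_mul]
    refine integral_mono (((i0.const_mul _).add (i2.const_mul _)).const_mul _) ig fun z => ?_
    generalize x - lam • z = w
    have e : phi c (s / 2) w = phi c s w * (Real.exp (T / 4) * Real.exp (s / 4 * ‖w‖ ^ 2 - T / 4)) := by
      unfold phi
      rw [mul_assoc, ← Real.exp_add, ← Real.exp_add]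
      congr 2; ring
    have h1 := Real.add_one_le_exp (s / 4 * ‖w‖ ^ 2 - T / 4)
    have h2 := phi_nonneg (s := s) hc w
    have h3 := mul_le_mul_of_nonneg_left h1 (mul_pos h2 (Real.exp_pos (T / 4))).le
    simp only
    rw [e]
    linarith
  have hx' : T * ∫ z, phi c s (x - lam • z) ∂μ < s * ∫ z, phi c s (x - lam • z) * ‖x - lam • z‖ ^ 2 ∂μ := hx
  rw [Real.exp_neg, ← div_eq_inv_mul, le_div_iff₀ (Real.exp_pos _)]
  refine le_trans ?_ h
  rw [mul_comm]
  gcongr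
  linarith

lemma lint_g {d : ℕ} (μ : Measure (VV d)) [IsProbabilityMeasure μ] (lam : ℝ) {sig : ℝ}
    (hsig : 0 < sig) :
    ∫⁻ x : VV d, ∫⁻ z, ENNReal.ofReal (phi ((2 * π * sig ^ 2) ^ (-(d : ℝ) / 2)) (1 / sig ^ 2 / 2)
      (x - lam • z)) ∂μ = ENNReal.ofReal (2 ^ ((d : ℝ) / 2)) := by
  have hcont := phi_continuous (E := VV d) ((2 * π * sig ^ 2) ^ (-(d : ℝ) / 2)) (1 / sig ^ 2 / 2)
  have hc : 0 < (2 * π * sig ^ 2) ^ (-(d : ℝ) / 2) := by positivity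
  rw [lintegral_lintegral_swap]
  swap
  · refine Measurable.aemeasurable (Continuous.measurable ?_)
    unfold Function.uncurry
    exact ENNReal.continuous_ofReal.comp (by fun_prop)
  have : ∀ z : VV d, ∫⁻ x : VV d, ENNReal.ofReal (phi ((2 * π * sig ^ 2) ^ (-(d : ℝ) / 2))
      (1 / sig ^ 2 / 2) (x - lam • z)) = ENNReal.ofReal (2 ^ ((d : ℝ) / 2)) := by
    intro z
    rw [lintegral_sub_right_eq_self (fun x : VV d => ENNReal.ofReal (phi ((2 * π * sig ^ 2) ^ (-(d : ℝ) / 2))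
      (1 / sig ^ 2 / 2) x))]
    have e : ∀ x : VV d, phi ((2 * π * sig ^ 2) ^ (-(d : ℝ) / 2)) (1 / sig ^ 2 / 2) x =
      (2 * π * sig ^ 2) ^ (-(d : ℝ) / 2) * Real.exp (-(1 / sig ^ 2 / 4) * ‖x‖ ^ 2) := by
      intro x
      unfold phi
      congr 2; ring
    have hI := GaussianFourier.integral_rexp_neg_mul_sq_norm (V := VV d) (b := 1 / sig ^ 2 / 4) (by positivity)
    have hint : Integrable fun x : VV d => Real.exp (-(1 / sig ^ 2 / 4) * ‖x‖ ^ 2) := by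
      by_contra hn
      rw [integral_undef hn] at hI
      have : 0 < (π / (1 / sig ^ 2 / 4)) ^ ((Module.finrank ℝ (VV d) : ℝ) / 2) := by positivity
      linarith
    rw [← ofReal_integral_eq_lintegral_ofReal]
    · congr 1
      simp_rw [e]
      rw [integral_const_mul, hI, finrank_euclideanSpace_fin, neg_div, Real.rpow_neg (by positivity),
        ← div_eq_inv_mul, ← Real.div_rpow (by positivity) (by positivity)]
      congr 1
      field_simp
      norm_num
    · rw [funext e]
      exact hint.const_mul _
    · exact Filter.Eventually.of_forall fun x => (phi_nonneg hc x).le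
  simp_rw [this]
  simp

lemma tail {d : ℕ} (μ : Measure (VV d)) [IsProbabilityMeasure μ] (lam : ℝ) {sig : ℝ}
    (hsig : 0 < sig) (T : ℝ) (F : VV d → ℝ) {A : ℝ} (hA : 0 ≤ A)
    (hF : ∀ x, F x ≤ A * smoothedDensity d lam sig μ x) :
    (volume.withDensity fun x => ENNReal.ofReal (F x))
      (bad ((2 * π * sig ^ 2) ^ (-(d : ℝ) / 2)) (1 / sig ^ 2) lam μ T)
      ≤ ENNReal.ofReal (A * (Real.exp (-(T / 4)) * 2 ^ ((d : ℝ) / 2))) := by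
  have hc : 0 < (2 * π * sig ^ 2) ^ (-(d : ℝ) / 2) := by positivity
  have hs : 0 < 1 / sig ^ 2 := by positivity
  have hcont := phi_continuous (E := VV d) ((2 * π * sig ^ 2) ^ (-(d : ℝ) / 2)) (1 / sig ^ 2 / 2)
  have hm : Measurable fun x : VV d => ∫⁻ z, ENNReal.ofReal (phi ((2 * π * sig ^ 2) ^ (-(d : ℝ) / 2))
      (1 / sig ^ 2 / 2) (x - lam • z)) ∂μ := by
    refine Measurable.lintegral_prod_right' (f := fun p : VV d × VV d => ENNReal.ofReal
      (phi ((2 * π * sig ^ 2) ^ (-(d : ℝ) / 2)) (1 / sig ^ 2 / 2) (p.1 - lam • p.2))) ?_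
    exact Continuous.measurable (ENNReal.continuous_ofReal.comp (by fun_prop))
  rw [withDensity_apply']
  calc _ ≤ ∫⁻ x in bad ((2 * π * sig ^ 2) ^ (-(d : ℝ) / 2)) (1 / sig ^ 2) lam μ T,
        ENNReal.ofReal (A * Real.exp (-(T / 4))) * ∫⁻ z, ENNReal.ofReal (phi ((2 * π * sig ^ 2) ^ (-(d : ℝ) / 2))
      (1 / sig ^ 2 / 2) (x - lam • z)) ∂μ := by
        refine setLIntegral_mono (hm.const_mul _) fun x hx => ?_
        rw [← ofReal_integral_eq_lintegral_ofReal (int_phi μ lam hc (half_pos hs) x)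
          (Filter.Eventually.of_forall fun x => (phi_nonneg hc _).le),
          ← ENNReal.ofReal_mul (by positivity)]
        refine ENNReal.ofReal_le_ofReal ((hF x).trans ?_)
        unfold smoothedDensity
        simp_rw [kernel_eq]
        rw [mul_assoc A]
        exact mul_le_mul_of_nonneg_left (bad_le μ lam hc hs hx) hA
    _ ≤ ∫⁻ x, ENNReal.ofReal (A * Real.exp (-(T / 4))) * ∫⁻ z, ENNReal.ofReal (phi ((2 * π * sig ^ 2) ^ (-(d : ℝ) / 2))
      (1 / sig ^ 2 / 2) (x - lam • z)) ∂μ := setLIntegral_le_lintegral _ _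
    _ = _ := by
      rw [lintegral_const_mul _ hm, lint_g μ lam hsig, ← ENNReal.ofReal_mul (by positivity), mul_assoc]

section mix

lemma mix_prob {d : ℕ} {𝒴 : Type} [Fintype 𝒴] (prior : 𝒴 → ℝ)
    (hprior : ∀ y', 0 < prior y' ∧ prior y' ≤ 1) (hsum : ∑ y', prior y' = 1)
    (μs : 𝒴 → Measure (VV d)) (hμs : ∀ y', IsProbabilityMeasure (μs y')) : IsProbabilityMeasure (mixture prior μs) := by
  constructor
  unfold mixture
  simp only [Measure.coe_finsetSum, Finset.sum_apply, Measure.smul_apply, measure_univ, smul_eq_mul, mul_one]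
  rw [← ENNReal.ofReal_sum_of_nonneg fun i _ => (hprior i).1.le, hsum, ENNReal.ofReal_one]

lemma mix_dens {d : ℕ} {𝒴 : Type} [Fintype 𝒴] (prior : 𝒴 → ℝ)
    (hprior : ∀ y', 0 < prior y' ∧ prior y' ≤ 1) (hsum : ∑ y', prior y' = 1)
    (μs : 𝒴 → Measure (VV d)) (hμs : ∀ y', IsProbabilityMeasure (μs y'))
     (lam : ℝ) {sig : ℝ} (hsig : 0 < sig) (y : 𝒴) (x : VV d) :
    smoothedDensity d lam sig (μs y) x ≤ 1 / prior y * smoothedDensity d lam sig (mixture prior μs) x := by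
  have := mix_prob prior hprior hsum μs hμs
  have hp := (hprior y).1
  have hc : 0 < (2 * π * sig ^ 2) ^ (-(d : ℝ) / 2) := by positivity
  have hs : 0 < 1 / sig ^ 2 := by positivity
  rw [one_div, ← div_eq_inv_mul, le_div_iff₀ hp, mul_comm]
  unfold smoothedDensity
  simp_rw [kernel_eq]
  have hle : ENNReal.ofReal (prior y) • μs y ≤ mixture prior μs := by
    unfold mixture
    exact Finset.single_le_sum (f := fun y' => ENNReal.ofReal (prior y') • μs y')
      (fun i _ => Measure.zero_le _) (Finset.mem_univ y)
  have := integral_mono_measure hle (Filter.Eventually.of_forall fun z => (phi_nonneg hc (x - lam • z)).le)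
    (int_phi (mixture prior μs) lam hc hs x)
  rwa [integral_smul_measure, ENNReal.toReal_ofReal hp.le] at this

lemma tail_union (d : ℕ) {𝒴 : Type} [Fintype 𝒴] (prior : 𝒴 → ℝ)
    (hprior : ∀ y', 0 < prior y' ∧ prior y' ≤ 1) (hsum : ∑ y', prior y' = 1)
    (μs : 𝒴 → Measure (VV d)) (hμs : ∀ y', IsProbabilityMeasure (μs y'))
    (hd : 0 < d) (lam : ℝ) {sig : ℝ} (hsig : 0 < sig) (y : 𝒴) {ε : ℝ} (hε : 0 < ε)
    (hε1 : ε < 1) :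
    (volume.withDensity fun x => ENNReal.ofReal (smoothedDensity d lam sig (μs y) x))
      (bad ((2 * π * sig ^ 2) ^ (-(d : ℝ) / 2)) (1 / sig ^ 2) lam (μs y) (8 * (d + Real.log (1 / ε))) ∪
       bad ((2 * π * sig ^ 2) ^ (-(d : ℝ) / 2)) (1 / sig ^ 2) lam (mixture prior μs)
        (8 * (d + Real.log (1 / ε)))) ≤ ENNReal.ofReal (ε / prior y) := by
  have := mix_prob prior hprior hsum μs hμs
  have := hμs y
  have hp := (hprior y).1
  have hp1 := (hprior y).2
  have hL : 0 < Real.log (1 / ε) := Real.log_pos (by rw [lt_div_iff₀ hε]; linarith)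
  have hd1 : (1 : ℝ) ≤ d := by exact_mod_cast hd
  have hnum : Real.exp (-(8 * (d + Real.log (1 / ε)) / 4)) * 2 ^ ((d : ℝ) / 2) ≤ ε / 2 := by
    have e1 : (2 : ℝ) ^ ((d : ℝ) / 2) ≤ Real.exp d := by
      rw [Real.rpow_def_of_pos (by norm_num), Real.exp_le_exp]
      nlinarith [Real.log_two_lt_d9]
    have e2 : ε / 2 = Real.exp (-Real.log (1 / ε) - Real.log 2) := by
      rw [Real.exp_sub, one_div, Real.log_inv, neg_neg, Real.exp_log hε, Real.exp_log (by norm_num)]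
    calc _ ≤ Real.exp (-(8 * (d + Real.log (1 / ε)) / 4)) * Real.exp d := by gcongr
      _ ≤ _ := by
        rw [e2, ← Real.exp_add, Real.exp_le_exp]
        linarith [Real.log_two_lt_d9]
  refine (measure_union_le _ _).trans ?_
  have hinv : 0 ≤ 1 / prior y := by positivity
  have t1 := tail (μs y) lam hsig (8 * (d + Real.log (1 / ε))) (smoothedDensity d lam sig (μs y))
    (A := 1 / prior y) hinv (fun x => by
      have h1 : 1 ≤ 1 / prior y := by rw [le_div_iff₀ hp]; linarith
      have h2 : 0 ≤ smoothedDensity d lam sig (μs y) x := integral_nonneg fun z => by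
        unfold gaussKernel; positivity
      nlinarith)
  have t2 := tail (mixture prior μs) lam hsig (8 * (d + Real.log (1 / ε))) (smoothedDensity d lam sig (μs y))
    (A := 1 / prior y) hinv (mix_dens prior hprior hsum μs hμs lam hsig y)
  refine (add_le_add t1 t2).trans ?_
  rw [← ENNReal.ofReal_add (by positivity) (by positivity)]
  refine ENNReal.ofReal_le_ofReal ?_
  have := mul_le_mul_of_nonneg_left hnum hinv
  have e : ε / prior y = 1 / prior y * (ε / 2) + 1 / prior y * (ε / 2) := by ring
  linarith

lemma good {d : ℕ} (μ : Measure (VV d)) [IsProbabilityMeasure μ] (lam : ℝ) {sig : ℝ} (hsig : 0 < sig)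
    {T : ℝ} (x : VV d)
    (hx : x ∉ bad ((2 * π * sig ^ 2) ^ (-(d : ℝ) / 2)) (1 / sig ^ 2) lam μ T) :
    ‖gradient (fun x => Real.log (smoothedDensity d lam sig μ x)) x‖ ^ 2 ≤ T * (1 / sig ^ 2) ∧
    -(d * (1 / sig ^ 2)) ≤ hessTrace (fun x => Real.log (smoothedDensity d lam sig μ x)) x ∧
    hessTrace (fun x => Real.log (smoothedDensity d lam sig μ x)) x ≤
      -(d * (1 / sig ^ 2)) + T * (1 / sig ^ 2) := by
  have hc : 0 < (2 * π * sig ^ 2) ^ (-(d : ℝ) / 2) := by positivity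
  have hs : 0 < 1 / sig ^ 2 := by positivity
  have h := key μ lam (EuclideanSpace.basisFun (Fin d) ℝ) hc hs x (not_lt.1 hx)
  unfold hessTrace smoothedDensity
  simp_rw [kernel_eq, iteratedFDeriv_two_apply]
  simpa using h

lemma pointwise {d : ℕ} {𝒴 : Type} [Fintype 𝒴] (prior : 𝒴 → ℝ)
    (hprior : ∀ y', 0 < prior y' ∧ prior y' ≤ 1) (hsum : ∑ y', prior y' = 1)
    (μs : 𝒴 → Measure (VV d)) (hμs : ∀ y', IsProbabilityMeasure (μs y'))
     (lam : ℝ) {sig : ℝ} (hsig : 0 < sig) (y : 𝒴) {ε : ℝ} (hε : 0 < ε)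
    (hε1 : ε < 1) (x : VV d)
    (hx : x ∉ bad ((2 * π * sig ^ 2) ^ (-(d : ℝ) / 2)) (1 / sig ^ 2) lam (μs y)
        (8 * (d + Real.log (1 / ε))) ∪
       bad ((2 * π * sig ^ 2) ^ (-(d : ℝ) / 2)) (1 / sig ^ 2) lam (mixture prior μs)
        (8 * (d + Real.log (1 / ε)))) :
    ‖gradient (fun x => Real.log (smoothedDensity d lam sig (μs y) x)) x -
      gradient (fun x => Real.log (smoothedDensity d lam sig (mixture prior μs) x)) x‖ ≤
        8 * Real.sqrt ((d : ℝ) + Real.log (1 / ε)) / sig ∧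
    |hessTrace (fun x => Real.log (smoothedDensity d lam sig (μs y) x)) x -
      hessTrace (fun x => Real.log (smoothedDensity d lam sig (mixture prior μs) x)) x| ≤
        8 * ((d : ℝ) + Real.log (1 / ε)) / sig ^ 2 := by
  have := mix_prob prior hprior hsum μs hμs
  have := hμs y
  have hL : 0 < Real.log (1 / ε) := Real.log_pos (by rw [lt_div_iff₀ hε]; linarith)
  rw [Set.mem_union, not_or] at hx
  obtain ⟨a1, a2, a3⟩ := good (μs y) lam hsig x hx.1
  obtain ⟨b1, b2, b3⟩ := good (mixture prior μs) lam hsig x hx.2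
  have hD : 0 ≤ (d : ℝ) + Real.log (1 / ε) := by positivity
  generalize (d : ℝ) + Real.log (1 / ε) = D at *
  constructor
  · have hb : ∀ g : VV d, ‖g‖ ^ 2 ≤ 8 * D * (1 / sig ^ 2) → ‖g‖ ≤ 4 * Real.sqrt D / sig := by
      intro g hg
      refine abs_le_of_sq_le_sq' ?_ (by positivity) |>.2
      refine hg.trans ?_
      rw [div_pow, mul_pow, Real.sq_sqrt hD, mul_one_div]
      gcongr
      norm_num
    refine (norm_sub_le _ _).trans ((add_le_add (hb _ a1) (hb _ b1)).trans (le_of_eq ?_))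
    ring
  · rw [abs_le, ← mul_one_div]
    constructor <;> linarith

end mix


theorem stmt9 : ∃ C : ℝ, 0 < C ∧
    ∀ (d : ℕ) (𝒴 : Type) (_ : Fintype 𝒴) (prior : 𝒴 → ℝ),
      (∀ y', 0 < prior y' ∧ prior y' ≤ 1) → (∑ y', prior y' = 1) →
    ∀ (μs : 𝒴 → Measure (EuclideanSpace ℝ (Fin d))),
      (∀ y', IsProbabilityMeasure (μs y')) →
    ∀ lam sig : ℝ, lam ∈ Set.Ioc (0 : ℝ) 1 → 0 < sig →
    ∀ y : 𝒴, ∀ ε : ℝ, 0 < ε → ε < 1 →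
      (volume.withDensity fun x => ENNReal.ofReal (smoothedDensity d lam sig (μs y) x))
        {x | C * Real.sqrt ((d : ℝ) + Real.log (1 / ε)) / sig <
          ‖gradient (fun x => Real.log (smoothedDensity d lam sig (μs y) x)) x -
            gradient (fun x => Real.log (smoothedDensity d lam sig (mixture prior μs) x)) x‖}
        ≤ ENNReal.ofReal (ε / prior y) ∧
      (volume.withDensity fun x => ENNReal.ofReal (smoothedDensity d lam sig (μs y) x))
        {x | C * ((d : ℝ) + Real.log (1 / ε)) / sig ^ 2 <
          |hessTrace (fun x => Real.log (smoothedDensity d lam sig (μs y) x)) x -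
            hessTrace (fun x => Real.log (smoothedDensity d lam sig (mixture prior μs) x)) x|}
        ≤ ENNReal.ofReal (ε / prior y) := by
  refine ⟨8, by norm_num, ?_⟩
  intro d 𝒴 _ prior hprior hsum μs hμs lam sig hlam hsig y ε hε hε1
  rcases Nat.eq_zero_or_pos d with rfl | hd
  · have hL : 0 ≤ Real.log (1 / ε) := Real.log_nonneg (by rw [le_div_iff₀ hε]; linarith)
    constructor
    · refine (le_of_eq ?_).trans (zero_le (a := ENNReal.ofReal (ε / prior y)))
      convert measure_empty (μ := volume.withDensity fun x => ENNReal.ofReal (smoothedDensity 0 lam sig (μs y) x))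
      ext x
      simp only [Set.mem_ofPred_eq, Set.mem_empty_iff_false, iff_false, not_lt]
      rw [Subsingleton.elim (gradient _ x - gradient _ x) 0, norm_zero]
      positivity
    · refine (le_of_eq ?_).trans (zero_le (a := ENNReal.ofReal (ε / prior y)))
      convert measure_empty (μ := volume.withDensity fun x => ENNReal.ofReal (smoothedDensity 0 lam sig (μs y) x))
      ext x
      simp only [Set.mem_ofPred_eq, Set.mem_empty_iff_false, iff_false, not_lt]
      simp only [hessTrace, Finset.univ_eq_empty, Finset.sum_empty, sub_zero, abs_zero]
      positivity
  · have := tail_union d prior hprior hsum μs hμs hd lam hsig y hε hε1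
    refine ⟨(measure_mono ?_).trans this, (measure_mono ?_).trans this⟩
    · intro x hx
      by_contra hn
      exact absurd (pointwise prior hprior hsum μs hμs lam hsig y hε hε1 x hn).1 (not_le.2 hx)
    · intro x hx
      by_contra hn
      exact absurd (pointwise prior hprior hsum μs hμs lam hsig y hε hε1 x hn).2 (not_le.2 hx)
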